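/- arXiv:1203.4767 — 2 statements merged into one kernel-verified Lean document; each statement's English description precedes it below -/
import Mathlib

section
/- Let E be a finite-dimensional real inner product space and let h : E → ℝ be a C² function whose Hessian satisfies m‖v‖² ≤ ⟪v, H(Y)v⟫ ≤ M‖v‖² for all Y, v ∈ E, where 0 < m ≤ M. Then there exist constants b₀ ∈ ℝ and b₁ > 0 such that for all Y ∈ E: ⟪Y, grad h(Y)⟫ − h(Y) ≥ b₁·‖grad h(Y)‖² − b₀. In particular, for every τ₂ > 0 the Kähler potential κ(Y) = 2τ₂(⟪Y, grad h(Y)⟫ − h(Y)) satisfies exp(−κ(Y)) ≤ exp(2τ₂b₀)·exp(−2τ₂b₁‖grad h(Y)‖²). -/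
open RealInnerProductSpace

lemma taylor_aux (f f' f'' : ℝ → ℝ) (h1 : ∀ t, HasDerivAt f (f' t) t)
    (h2 : ∀ t, HasDerivAt f' (f'' t) t) (h3 : ∀ t, 0 ≤ f'' t) : f 0 + f' 0 ≤ f 1 := by
  have hmono : Monotone f' := monotone_of_deriv_nonneg (fun t => (h2 t).differentiableAt)
    (fun t => by rw [(h2 t).deriv]; exact h3 t)
  obtain ⟨c, hc, hc2⟩ := exists_hasDerivAt_eq_slope f f' (zero_lt_one)
    (fun t _ => (h1 t).continuousAt.continuousWithinAt) (fun t _ => h1 t)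
  have := hmono hc.1.le
  simp at hc2
  linarith

/-- **Coercivity of the Kähler potential in terms of the gradient.**
Let `h : E → ℝ` be `C²` with `m‖v‖² ≤ ⟪v, H(Y)v⟫ ≤ M‖v‖²` for all `Y, v`, where
`0 < m ≤ M`. Then there are constants `b₀ ∈ ℝ` and `b₁ > 0` with
`⟪Y, grad h(Y)⟫ − h(Y) ≥ b₁‖grad h(Y)‖² − b₀` for all `Y`; in particular, for every
`τ₂ > 0` the Kähler potential `κ(Y) = 2τ₂(⟪Y, grad h(Y)⟫ − h(Y))` satisfies
`exp(−κ(Y)) ≤ exp(2τ₂b₀)·exp(−2τ₂b₁‖grad h(Y)‖²)`. -/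
theorem kahlerPotential_coercive_in_gradient
    {E : Type*} [NormedAddCommGroup E] [InnerProductSpace ℝ E] [FiniteDimensional ℝ E]
    (h : E → ℝ) (hh : ContDiff ℝ 2 h)
    (m M : ℝ) (hm : 0 < m) (hmM : m ≤ M)
    (hlow : ∀ Y v : E, m * ‖v‖ ^ 2 ≤ ⟪v, fderiv ℝ (gradient h) Y v⟫)
    (hup : ∀ Y v : E, ⟪v, fderiv ℝ (gradient h) Y v⟫ ≤ M * ‖v‖ ^ 2) :
    ∃ b₀ b₁ : ℝ, 0 < b₁ ∧
      (∀ Y : E, b₁ * ‖gradient h Y‖ ^ 2 - b₀ ≤ ⟪Y, gradient h Y⟫ - h Y) ∧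
      ∀ τ₂ : ℝ, 0 < τ₂ → ∀ Y : E,
        Real.exp (-(2 * τ₂ * (⟪Y, gradient h Y⟫ - h Y))) ≤
          Real.exp (2 * τ₂ * b₀) * Real.exp (-(2 * τ₂ * b₁ * ‖gradient h Y‖ ^ 2)) := by
  have hg : ∀ Y, HasGradientAt h (gradient h Y) Y := fun Y =>
    ((hh.differentiable (by norm_num)) Y).hasGradientAt
  have hgd : Differentiable ℝ (gradient h) := by
    have h1 : ContDiff ℝ 1 (fderiv ℝ h) := hh.fderiv_right (by norm_num)
    have h2 : Differentiable ℝ (fderiv ℝ h) := h1.differentiable (by norm_num)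
    exact (InnerProductSpace.toDual ℝ E).symm.toContinuousLinearEquiv.differentiable.comp h2
  have hline : ∀ (Y v : E) (t : ℝ), HasDerivAt (fun t : ℝ => Y + t • v) v t := fun Y v t => by
    simpa using ((hasDerivAt_id t).smul_const v).const_add Y
  have d1 : ∀ (Y v : E) (t : ℝ), HasDerivAt (fun t : ℝ => h (Y + t • v))
      ⟪v, gradient h (Y + t • v)⟫ t := fun Y v t => by
    have := (hg (Y + t • v)).hasFDerivAt.comp_hasDerivAt t (hline Y v t)
    rw [real_inner_comm]
    exact this
  have d2 : ∀ (Y v : E) (t : ℝ), HasDerivAt (fun t : ℝ => ⟪v, gradient h (Y + t • v)⟫)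
      ⟪v, fderiv ℝ (gradient h) (Y + t • v) v⟫ t := fun Y v t => by
    have := (hgd (Y + t • v)).hasFDerivAt.comp_hasDerivAt t (hline Y v t)
    simpa using (hasDerivAt_const t v).inner ℝ this
  have low : ∀ Y v : E, h Y + ⟪v, gradient h Y⟫ ≤ h (Y + v) := fun Y v => by
    have := taylor_aux _ _ _ (d1 Y v) (d2 Y v)
      (fun t => le_trans (by positivity) (hlow (Y + t • v) v))
    simpa using this
  have up : ∀ v : E, h v ≤ h 0 + ⟪v, gradient h 0⟫ + M / 2 * ‖v‖ ^ 2 := fun v => by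
    have e1 : ∀ t : ℝ, HasDerivAt (fun t : ℝ => M / 2 * ‖v‖ ^ 2 * t ^ 2) (M * ‖v‖ ^ 2 * t) t :=
      fun t => by
        refine ((hasDerivAt_pow 2 t).const_mul (M / 2 * ‖v‖ ^ 2)).congr_deriv ?_
        push_cast
        ring
    have e2 : ∀ t : ℝ, HasDerivAt (fun t : ℝ => M * ‖v‖ ^ 2 * t) (M * ‖v‖ ^ 2) t :=
      fun t => by simpa using (hasDerivAt_id t).const_mul (M * ‖v‖ ^ 2)
    have := taylor_aux _ _ _ (fun t => (e1 t).sub (d1 0 v t)) (fun t => (e2 t).sub (d2 0 v t))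
      (fun t => sub_nonneg.2 (hup _ v))
    simp only [Pi.sub_apply, zero_smul, one_smul, zero_add, add_zero] at this
    linarith
  have hM : 0 < M := hm.trans_le hmM
  have key : ∀ Y : E, 1 / (4 * M) * ‖gradient h Y‖ ^ 2 - (h 0 + ‖gradient h 0‖ ^ 2 / M)
      ≤ ⟪Y, gradient h Y⟫ - h Y := fun Y => by
    set u := gradient h Y with hu
    set g := gradient h 0 with hgdef
    have a := low Y (M⁻¹ • u - Y)
    have b := up (M⁻¹ • u)
    rw [add_sub_cancel, inner_sub_left, real_inner_smul_left, real_inner_self_eq_norm_sq,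
      ← hu] at a
    rw [real_inner_smul_left, norm_smul, Real.norm_of_nonneg (by positivity)] at b
    have c : ⟪u, g⟫ ≤ ‖u‖ ^ 2 / 4 + ‖g‖ ^ 2 := by
      nlinarith [real_inner_le_norm u g, sq_nonneg (‖u‖ / 2 - ‖g‖)]
    have c' := mul_le_mul_of_nonneg_left c (inv_pos.2 hM).le
    have e : M / 2 * (M⁻¹ * ‖u‖) ^ 2 = M⁻¹ * ‖u‖ ^ 2 / 2 := by field_simp
    have e3 : 1 / (4 * M) * ‖u‖ ^ 2 = M⁻¹ * ‖u‖ ^ 2 / 4 := by field_simp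
    have e4 : ‖g‖ ^ 2 / M = M⁻¹ * ‖g‖ ^ 2 := by field_simp
    rw [e] at b
    rw [e3, e4]
    linarith
  refine ⟨_, _, by positivity, key, fun τ hτ Y => ?_⟩
  rw [← Real.exp_add]
  apply Real.exp_le_exp.2
  have := mul_le_mul_of_nonneg_left (key Y) (by positivity : 0 ≤ 2 * τ)
  linarith
end

section
/- Let E be a finite-dimensional real inner product space and let h : E → ℝ be a C² function whose Hessian satisfies m‖v‖² ≤ ⟪v, H(Y)v⟫ ≤ M‖v‖² for all Y, v ∈ E, where 0 < m ≤ M. Then for every τ₂ > 0 and every c ≥ 0, the integral over E (with respect to Lebesgue measure) of the function Y ↦ exp(c·‖grad h(Y)‖ − 2τ₂(⟪Y, grad h(Y)⟫ − h(Y))) · √(det H(Y)) is finite. -/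
open RealInnerProductSpace MeasureTheory

/-- **Square-integrability density estimate for the measure `dμ_τ`.**
Let `h : E → ℝ` be `C²` with `m‖v‖² ≤ ⟪v, H(Y)v⟫ ≤ M‖v‖²` for all `Y, v`, where
`0 < m ≤ M`. Then for every `τ₂ > 0` and every `c ≥ 0`, the function
`Y ↦ exp(c‖grad h(Y)‖ − 2τ₂(⟪Y, grad h(Y)⟫ − h(Y))) · √(det H(Y))`
is integrable on `E` with respect to (any) Lebesgue (additive Haar) measure. -/
theorem integrable_density_exp_gradient
    {E : Type*} [NormedAddCommGroup E] [InnerProductSpace ℝ E] [FiniteDimensional ℝ E]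
    [MeasurableSpace E] [BorelSpace E]
    (μ : Measure E) [μ.IsAddHaarMeasure]
    (h : E → ℝ) (hh : ContDiff ℝ 2 h)
    (m M : ℝ) (hm : 0 < m) (hmM : m ≤ M)
    (hlow : ∀ Y v : E, m * ‖v‖ ^ 2 ≤ ⟪v, fderiv ℝ (gradient h) Y v⟫)
    (hup : ∀ Y v : E, ⟪v, fderiv ℝ (gradient h) Y v⟫ ≤ M * ‖v‖ ^ 2)
    (τ₂ c : ℝ) (hτ : 0 < τ₂) (hc : 0 ≤ c) :
    Integrable (fun Y : E =>
      Real.exp (c * ‖gradient h Y‖ - 2 * τ₂ * (⟪Y, gradient h Y⟫ - h Y)) *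
        Real.sqrt (LinearMap.det ((fderiv ℝ (gradient h) Y : E →L[ℝ] E) : E →ₗ[ℝ] E))) μ := by
  have hM : 0 < M := lt_of_lt_of_le hm hmM
  have hfd : ContDiff ℝ 1 (fderiv ℝ h) := hh.fderiv_right (by norm_num)
  have hgeq : gradient h = fun Y => (InnerProductSpace.toDual ℝ E).symm (fderiv ℝ h Y) := rfl
  have hg : ContDiff ℝ 1 (gradient h) := by
    rw [hgeq]
    exact (InnerProductSpace.toDual ℝ E).symm.toContinuousLinearEquiv.contDiff.comp hfd
  have hgd : Differentiable ℝ (gradient h) := hg.differentiable (by norm_num)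
  have hhd : Differentiable ℝ h := hh.differentiable (by norm_num)
  have hinner : ∀ Y v : E, fderiv ℝ h Y v = ⟪gradient h Y, v⟫ := by
    intro Y v
    rw [hgeq]
    simp
  have hH : ∀ Y u v : E, ⟪fderiv ℝ (gradient h) Y u, v⟫ = fderiv ℝ (fderiv ℝ h) Y u v := by
    intro Y u v
    have e1 := (hgd Y).hasFDerivAt.inner ℝ (hasFDerivAt_const v Y)
    have e2 := (hfd.differentiable (by norm_num) Y).hasFDerivAt.clm_apply (hasFDerivAt_const v Y)
    have e3 : (fun Y => ⟪gradient h Y, v⟫) = fun Y => fderiv ℝ h Y v :=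
      funext fun Y => (hinner Y v).symm
    rw [e3] at e1
    have := congrArg (fun A => A u) (e1.unique e2)
    simpa using this
  have hsymm : ∀ Y u v : E, ⟪u, fderiv ℝ (gradient h) Y v⟫ = ⟪v, fderiv ℝ (gradient h) Y u⟫ := by
    intro Y u v
    rw [real_inner_comm, hH, real_inner_comm, hH]
    exact (hh.contDiffAt.isSymmSndFDerivAt (by simp)) v u
  have hpol : ∀ Y u v : E, ⟪u, fderiv ℝ (gradient h) Y v⟫ ≤ M / 2 * (‖u‖ ^ 2 + ‖v‖ ^ 2) := by
    intro Y u v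
    have h1 := hup Y (u + v)
    have h2 := hlow Y (u - v)
    have h3 : 0 ≤ m * ‖u - v‖ ^ 2 := by positivity
    have h4 := hsymm Y u v
    have h5 := parallelogram_law_with_norm ℝ u v
    simp only [map_add, map_sub, inner_add_left, inner_add_right, inner_sub_left,
      inner_sub_right] at h1 h2
    have h6 : M * ‖u + v‖ ^ 2 ≤ M * (2 * (‖u‖ ^ 2 + ‖v‖ ^ 2)) := by
      apply mul_le_mul_of_nonneg_left _ hM.le
      nlinarith [sq_nonneg ‖u - v‖]
    nlinarith
  have hnorm : ∀ Y : E, ‖fderiv ℝ (gradient h) Y‖ ≤ M := by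
    intro Y
    refine ContinuousLinearMap.opNorm_le_bound _ hM.le fun v => ?_
    have h1 := hpol Y (fderiv ℝ (gradient h) Y v) (M • v)
    rw [map_smul, inner_smul_right, real_inner_self_eq_norm_sq, norm_smul, Real.norm_of_nonneg hM.le]
      at h1
    have h2 : ‖fderiv ℝ (gradient h) Y v‖ ^ 2 ≤ (M * ‖v‖) ^ 2 := by
      have : M * (‖fderiv ℝ (gradient h) Y v‖ ^ 2) ≤ M * (M * ‖v‖) ^ 2 := by linarith
      exact le_of_mul_le_mul_left this hM
    exact le_of_sq_le_sq h2 (by positivity)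
  have hgrow : ∀ Y : E, ‖gradient h Y‖ ≤ ‖gradient h 0‖ + M * ‖Y‖ := by
    intro Y
    have h1 := Convex.norm_image_sub_le_of_norm_fderiv_le (𝕜 := ℝ) (f := gradient h) (C := M)
      (s := Set.univ) (x := 0) (y := Y) (fun x _ => hgd x) (fun x _ => hnorm x) convex_univ
      trivial trivial
    have h2 := norm_le_norm_add_norm_sub' (gradient h Y) (gradient h 0)
    rw [sub_zero] at h1
    linarith
  have hkap : ∀ Y : E, m / 2 * ‖Y‖ ^ 2 - h 0 ≤ ⟪Y, gradient h Y⟫ - h Y := by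
    intro Y
    let φ : ℝ → ℝ := fun t => t * ⟪Y, gradient h (t • Y)⟫ - h (t • Y) - m / 2 * ‖Y‖ ^ 2 * t ^ 2
    have hφ : ∀ t, HasDerivAt φ
        (t * (⟪Y, fderiv ℝ (gradient h) (t • Y) Y⟫ - m * ‖Y‖ ^ 2)) t := by
      intro t
      have a0 : HasDerivAt (fun t : ℝ => t • Y) Y t := by
        simpa using (hasDerivAt_id t).smul_const Y
      have a1 := (hgd (t • Y)).hasFDerivAt.comp_hasDerivAt t a0
      have a2 := (hhd (t • Y)).hasFDerivAt.comp_hasDerivAt t a0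
      have a3 := (hasDerivAt_const t Y).inner ℝ a1
      have a4 := (((hasDerivAt_id t).mul a3).sub a2).sub
        (((hasDerivAt_id t).pow 2).const_mul (m / 2 * ‖Y‖ ^ 2))
      refine HasDerivAt.congr_deriv (f := φ) a4 ?_
      have a5 := hinner (t • Y) Y
      rw [real_inner_comm] at a5
      simp only [Function.comp_apply, inner_zero_left, a5, id]
      push_cast
      ring
    have hmono : MonotoneOn φ (Set.Ici 0) := by
      apply monotoneOn_of_deriv_nonneg (convex_Ici 0)
      · exact fun t _ => (hφ t).continuousAt.continuousWithinAt
      · exact fun t _ => (hφ t).differentiableAt.differentiableWithinAt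
      · intro t ht
        rw [interior_Ici] at ht
        rw [(hφ t).deriv]
        exact mul_nonneg (le_of_lt ht) (sub_nonneg.2 (hlow _ _))
    have := hmono (Set.mem_Ici.2 le_rfl) (Set.mem_Ici.2 zero_le_one) zero_le_one
    simp only [φ, one_smul, zero_smul] at this
    linarith
  have hdetc : Continuous fun A : E →L[ℝ] E => Real.sqrt (LinearMap.det (A : E →ₗ[ℝ] E)) :=
    Real.continuous_sqrt.comp ContinuousLinearMap.continuous_det
  obtain ⟨D, hD⟩ : ∃ D, ∀ A : E →L[ℝ] E, ‖A‖ ≤ M →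
      Real.sqrt (LinearMap.det (A : E →ₗ[ℝ] E)) ≤ D := by
    obtain ⟨D, hD⟩ := (isCompact_closedBall (0 : E →L[ℝ] E) M).bddAbove_image hdetc.continuousOn
    exact ⟨D, fun A hA => hD ⟨A, by simpa using hA, rfl⟩⟩
  set b : ℝ := τ₂ * m with hb
  have hbpos : 0 < b := mul_pos hτ hm
  have hgauss : Integrable (fun Y : E => Real.exp (-(b / 2) * ‖Y‖ ^ 2)) μ := by
    have h1 : Integrable (fun Y : E => Real.exp (-(b / 2) * ‖Y‖ ^ 2)) (volume : Measure E) := by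
      have := (GaussianFourier.integrable_cexp_neg_mul_sq_norm_add (V := E) (b := ((b / 2 : ℝ) : ℂ))
        (by rw [Complex.ofReal_re]; positivity) 0 0).norm
      refine this.congr (Filter.Eventually.of_forall fun Y => ?_)
      simp only [Complex.norm_exp]
      congr 1
      rw [← Complex.ofReal_neg, ← Complex.ofReal_pow, ← Complex.ofReal_mul]
      simp [-Complex.ofReal_pow]
    rw [Measure.isAddLeftInvariant_eq_smul μ (volume : Measure E)]
    exact h1.smul_measure_nnreal
  let a := c * M
  let K := c * ‖gradient h 0‖ + 2 * τ₂ * h 0 + a ^ 2 / (2 * b)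
  refine (hgauss.const_mul (Real.exp K * D)).mono' ?_ (Filter.Eventually.of_forall fun Y => ?_)
  · apply Continuous.aestronglyMeasurable
    have c1 : Continuous (gradient h) := hg.continuous
    have c2 : Continuous h := hh.continuous
    have c3 : Continuous (fderiv ℝ (gradient h)) := hg.continuous_fderiv (by norm_num)
    exact (by fun_prop : Continuous fun Y : E =>
      Real.exp (c * ‖gradient h Y‖ - 2 * τ₂ * (⟪Y, gradient h Y⟫ - h Y))).mul (hdetc.comp c3)
  · rw [Real.norm_of_nonneg (by positivity)]
    have h1 := hD _ (hnorm Y)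
    have h2 : c * ‖gradient h Y‖ - 2 * τ₂ * (⟪Y, gradient h Y⟫ - h Y)
        ≤ K + -(b / 2) * ‖Y‖ ^ 2 := by
      have e1 := mul_le_mul_of_nonneg_left (hgrow Y) hc
      have e2 := mul_le_mul_of_nonneg_left (hkap Y) (by positivity : 0 ≤ 2 * τ₂)
      have e3 : a * ‖Y‖ ≤ a ^ 2 / (2 * b) + b / 2 * ‖Y‖ ^ 2 := by
        have : a ^ 2 / (2 * b) + b / 2 * ‖Y‖ ^ 2 - a * ‖Y‖ = (a - b * ‖Y‖) ^ 2 / (2 * b) := by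
          field_simp
          ring
        have : 0 ≤ (a - b * ‖Y‖) ^ 2 / (2 * b) := by positivity
        linarith
      simp only [K, a, hb] at *
      nlinarith
    calc _ ≤ Real.exp (K + -(b / 2) * ‖Y‖ ^ 2) * D :=
          mul_le_mul (Real.exp_le_exp.2 h2) h1 (Real.sqrt_nonneg _) (Real.exp_pos _).le
      _ = _ := by rw [Real.exp_add]; ring
end
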